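/- For every nonempty Σ¹₁ closed set A ⊆ ℕ^ℕ containing no computable element, there exists a nonempty Σ¹₁ closed set B ⊆ ℕ^ℕ such that A ∪ B contains no computable element and A is not Medvedev reducible to A ∪ B; hence ℕ^ℕ <_M A ∪ B <_M A, i.e., the Medvedev degrees of nonempty Σ¹₁ closed sets are downward dense above the trivial degree. -/

import Mathlib

open Set

/-- Baire space. -/
abbrev Baire : Type := ℕ → ℕ

/-- The length-`n` initial segment of `x : Baire`, as a finite sequence. -/
def pre (x : Baire) (n : ℕ) : List ℕ := (List.range n).map x

/-- A Turing functional, presented by a total computable monotone map on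
finite sequences. -/
structure TuringFunctional where
  φ : List ℕ → List ℕ
  computable : Computable φ
  mono : ∀ σ τ : List ℕ, σ <+: τ → φ σ <+: φ τ

/-- `Φ` is defined on `x` with value `y`: every coordinate of `y` is eventually
output by `Φ` on initial segments of `x`. -/
def TuringFunctional.Eval (Φ : TuringFunctional) (x y : Baire) : Prop :=
  ∀ n, ∃ m, (Φ.φ (pre x m))[n]? = some (y n)

/-- Medvedev reducibility: some Turing functional is defined on every element
of `Q` and maps `Q` into `P`. -/
def MedvedevLE (P Q : Set Baire) : Prop :=
  ∃ Φ : TuringFunctional, ∀ x ∈ Q, ∃ y ∈ P, Φ.Eval x y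

/-- Strict Medvedev reducibility. -/
def MedvedevLT (P Q : Set Baire) : Prop := MedvedevLE P Q ∧ ¬ MedvedevLE Q P

/-- The homogeneous set `∏ₙ Aₙ`. -/
def homProd (A : ℕ → Set ℕ) : Set Baire := {x | ∀ n, x n ∈ A n}

/-- A family `(Aₙ)` of subsets of `ℕ` is uniformly `Σ¹₁`. -/
def UniformlySigma11 (A : ℕ → Set ℕ) : Prop :=
  ∃ R : ℕ × ℕ → List ℕ → Bool, Computable₂ R ∧
    ∀ n m : ℕ, m ∈ A n ↔ ∃ y : Baire, ∀ k, R (n, m) (pre y k) = true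

/-- A subset of Baire space is (lightface) `Σ¹₁`. -/
def Sigma11Set (S : Set Baire) : Prop :=
  ∃ R : List ℕ → List ℕ → Bool, Computable₂ R ∧
    ∀ x, x ∈ S ↔ ∃ y : Baire, ∀ m, R (pre x m) (pre y m) = true

/-- A set of finite sequences is (lightface) `Σ¹₁`. -/
def Sigma11List (T : Set (List ℕ)) : Prop :=
  ∃ R : List ℕ → List ℕ → Bool, Computable₂ R ∧
    ∀ σ, σ ∈ T ↔ ∃ y : Baire, ∀ m, R σ (pre y m) = true

/-- A tree on `ℕ`: a set of finite sequences closed under prefixes. -/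
def IsTree (T : Set (List ℕ)) : Prop := ∀ σ ∈ T, ∀ τ : List ℕ, τ <+: σ → τ ∈ T

/-- The set `[T]` of infinite paths through `T`. -/
def paths (T : Set (List ℕ)) : Set Baire := {x | ∀ n, pre x n ∈ T}

/-- A subset of `ℕ × ℕ` is (lightface) `Σ¹₁`. -/
def Sigma11Pairs (A : Set (ℕ × ℕ)) : Prop :=
  ∃ R : ℕ × ℕ → List ℕ → Bool, Computable₂ R ∧
    ∀ p : ℕ × ℕ, p ∈ A ↔ ∃ y : Baire, ∀ k, R p (pre y k) = true

/-- A function `f : ℕ → ℕ` is `Δ¹₁`: its graph is both `Σ¹₁` and `Π¹₁`. -/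
def Delta11Fun (f : ℕ → ℕ) : Prop :=
  Sigma11Pairs {p : ℕ × ℕ | f p.1 = p.2} ∧ Sigma11Pairs {p : ℕ × ℕ | f p.1 ≠ p.2}

/-! ### Initial segments -/

theorem pre_length (x : Baire) (n : ℕ) : (pre x n).length = n := by simp [pre]

theorem pre_zero (x : Baire) : pre x 0 = [] := rfl

theorem pre_succ (x : Baire) (n : ℕ) : pre x (n + 1) = pre x n ++ [x n] := by
  simp [pre, List.range_succ]

theorem pre_succ' (x : Baire) (n : ℕ) : pre x (n + 1) = x 0 :: pre (fun i => x (i + 1)) n := by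
  simp [pre, List.range_succ_eq_map, Function.comp_def]

theorem pre_getElem?_of_lt (x : Baire) {n i : ℕ} (h : i < n) : (pre x n)[i]? = some (x i) := by
  simp [pre, h]

theorem pre_getElem?_of_le (x : Baire) {n i : ℕ} (h : n ≤ i) : (pre x n)[i]? = none := by
  simp [pre, h]

theorem pre_take (x : Baire) {n k : ℕ} (h : k ≤ n) : (pre x n).take k = pre x k := by
  simp [pre, ← List.map_take, List.take_range, h]

theorem pre_prefix (x : Baire) {k n : ℕ} (h : k ≤ n) : pre x k <+: pre x n := by
  rw [← pre_take x h]; exact List.take_prefix _ _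

theorem pre_eq_of_forall_getElem? {x : Baire} {s : List ℕ}
    (h : ∀ i v, s[i]? = some v → v = x i) : s = pre x s.length := by
  refine List.ext_getElem? fun i => ?_
  rcases lt_or_ge i s.length with hi | hi
  · rw [pre_getElem?_of_lt x hi, List.getElem?_eq_getElem hi]
    exact congrArg some (h i _ (List.getElem?_eq_getElem hi))
  · rw [pre_getElem?_of_le x hi, List.getElem?_eq_none hi]

theorem pre_computable {x : Baire} (hx : Computable x) : Computable (pre x) := by
  refine (Computable.nat_rec (f := id) (g := fun _ => ([] : List ℕ))
    (h := fun _ p => p.2 ++ [x p.1]) Computable.id (Computable.const _) ?_).of_eq fun n => ?_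
  · exact (Computable.list_concat.comp (Computable.snd.comp Computable.snd)
      (hx.comp (Computable.fst.comp Computable.snd))).to₂
  · dsimp only [id]
    induction n with
    | zero => rfl
    | succ n ih => rw [pre_succ, ← ih]

/-! ### Limits of increasing chains of finite sequences -/

/-- The point of Baire space determined by a strictly increasing chain of finite sequences. -/
def chainLimit (g : ℕ → List ℕ) : Baire := fun j => (g (j + 1)).getD j 0

section Chain

variable {g : ℕ → List ℕ}

theorem le_length_of_chain (hl : ∀ n, (g n).length < (g (n + 1)).length) (n : ℕ) :
    n ≤ (g n).length := by
  induction n with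
  | zero => exact Nat.zero_le _
  | succ n ih => exact Nat.succ_le_of_lt (ih.trans_lt (hl n))

theorem prefix_of_chain (hp : ∀ n, g n <+: g (n + 1)) {m n : ℕ} (h : m ≤ n) : g m <+: g n := by
  induction n, h using Nat.le_induction with
  | base => exact List.prefix_rfl
  | succ n _ ih => exact ih.trans (hp n)

theorem pre_chainLimit_prefix (hp : ∀ n, g n <+: g (n + 1))
    (hl : ∀ n, (g n).length < (g (n + 1)).length) (n : ℕ) : pre (chainLimit g) n <+: g n := by
  have hn := le_length_of_chain hl
  rw [List.prefix_iff_eq_take]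
  refine List.ext_getElem? fun i => ?_
  rw [pre_length]
  rcases lt_or_ge i n with hi | hi
  · rw [pre_getElem?_of_lt _ hi, List.getElem?_take_of_lt hi]
    have h1 : i < (g (i + 1)).length := hn (i + 1)
    obtain ⟨w, hw⟩ := prefix_of_chain hp (Nat.succ_le_of_lt hi)
    rw [← hw, List.getElem?_append_left h1]
    simp [chainLimit, List.getD, List.getElem?_eq_getElem h1]
  · rw [pre_getElem?_of_le _ hi, List.getElem?_eq_none (by simp; omega)]

end Chain

/-! ### Ranks of trees of finite sequences -/

/-- `t` is an immediate extension of `s` lying in `S`. -/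
def ChildRel (S : List ℕ → Prop) (t s : List ℕ) : Prop := ∃ a, t = s ++ [a] ∧ S t

open Classical in
/-- The rank of the node `s` in the tree `S`, which is `⊤` above ill-founded nodes. -/
noncomputable def treeRank (S : List ℕ → Prop) (s : List ℕ) : WithTop Ordinal.{0} :=
  if h : Acc (ChildRel S) s then (h.rank : Ordinal.{0}) else ⊤

theorem treeRank_lt_top {S : List ℕ → Prop} {s : List ℕ} :
    treeRank S s < ⊤ ↔ Acc (ChildRel S) s := by
  unfold treeRank
  split_ifs with h
  · simp [h, WithTop.coe_lt_top]
  · simp [h]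

theorem acc_childRel_nil_iff {S : List ℕ → Prop} (h0 : S []) :
    Acc (ChildRel S) [] ↔ ¬ ∃ y : Baire, ∀ k, S (pre y k) := by
  rw [← not_iff_not, not_acc_iff_exists_descending_chain, not_not]
  constructor
  · rintro ⟨f, hf0, hf⟩
    choose a ha hS using hf
    have : ∀ n, f n = pre a n := fun n => by
      induction n with
      | zero => exact hf0
      | succ n ih => rw [ha, ih, pre_succ]
    refine ⟨a, fun k => ?_⟩
    cases k with
    | zero => exact h0
    | succ k => rw [← this]; exact hS k
  · rintro ⟨y, hy⟩
    exact ⟨pre y, rfl, fun n => ⟨y n, pre_succ y n, hy _⟩⟩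

theorem treeRank_child_lt {S : List ℕ → Prop} {s : List ℕ} {a : ℕ} (hs : treeRank S s < ⊤)
    (h : S (s ++ [a])) : treeRank S (s ++ [a]) < treeRank S s := by
  have hs := treeRank_lt_top.1 hs
  have hr : ChildRel S (s ++ [a]) s := ⟨a, rfl, h⟩
  rw [treeRank, treeRank, dif_pos hs, dif_pos (hs.inv hr)]
  exact WithTop.coe_lt_coe.2 (hs.rank_lt_of_rel hr)

theorem exists_child_of_lt_treeRank {S : List ℕ → Prop} {o : WithTop Ordinal.{0}} {t : List ℕ}
    (h : o < treeRank S t) : ∃ b, S (t ++ [b]) ∧ o ≤ treeRank S (t ++ [b]) := by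
  by_cases ht : Acc (ChildRel S) t
  · lift o to Ordinal.{0} using h.ne_top
    rw [treeRank, dif_pos ht, WithTop.coe_lt_coe, Acc.rank_eq, Ordinal.lt_iSup_iff] at h
    obtain ⟨⟨_, b, rfl, hb⟩, ho⟩ := h
    refine ⟨b, hb, ?_⟩
    rw [treeRank, dif_pos (ht.inv ⟨b, rfl, hb⟩)]
    exact WithTop.coe_le_coe.2 (Order.lt_succ_iff.1 ho)
  · obtain ⟨_, hn, b, rfl, hb⟩ := exists_not_acc_lt_of_not_acc ht
    refine ⟨b, hb, ?_⟩
    rw [treeRank, dif_neg hn]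
    exact le_top

/-! ### Embeddings of trees -/

/-- `f` maps the tree `S` into the tree `S'`, strictly increasingly; if `strict` holds, it also
omits the root. -/
def TreeEmb (S S' : List ℕ → Prop) (strict : Prop) (f : List ℕ → List ℕ) : Prop :=
  ∀ s a, S s → (S' (f s) ∧ (strict → f s ≠ [])) ∧
    (S (s ++ [a]) → f s <+: f (s ++ [a]) ∧ (f s).length < (f (s ++ [a])).length)

section TreeEmb

variable {S S' : List ℕ → Prop} {strict : Prop}

theorem exists_treeEmb_of_root (hS : ∀ s t, s <+: t → S t → S s) {t₀ : List ℕ} (ht₀ : S' t₀)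
    (h0 : treeRank S [] ≤ treeRank S' t₀) (hfin : treeRank S [] < ⊤) (hs : strict → t₀ ≠ []) :
    ∃ f, TreeEmb S S' strict f := by
  classical
  let nxt : List ℕ → List ℕ → ℕ := fun s t =>
    if h : ∃ b, S' (t ++ [b]) ∧ treeRank S s ≤ treeRank S' (t ++ [b]) then h.choose else 0
  let F : List ℕ → List ℕ := fun l =>
    List.rec t₀ (fun a s ih => ih ++ [nxt (s.reverse ++ [a]) ih]) l
  have hF : ∀ s a, F (s ++ [a]).reverse = F s.reverse ++ [nxt (s ++ [a]) (F s.reverse)] := by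
    intro s a
    simp [F]
  have key : ∀ s, t₀ <+: F s.reverse ∧ (S s → S' (F s.reverse) ∧ treeRank S s < ⊤ ∧
      treeRank S s ≤ treeRank S' (F s.reverse)) := by
    intro s
    induction s using List.reverseRecOn with
    | nil => exact ⟨List.prefix_rfl, fun _ => ⟨ht₀, hfin, h0⟩⟩
    | append_singleton s a ih =>
      rw [hF]
      refine ⟨ih.1.trans (List.prefix_append _ _), fun h => ?_⟩
      obtain ⟨_, h1, h2⟩ := ih.2 (hS _ _ (List.prefix_append _ _) h)
      have hlt := treeRank_child_lt h1 h
      have hex := exists_child_of_lt_treeRank (hlt.trans_le h2)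
      have hn : nxt (s ++ [a]) (F s.reverse) = hex.choose := dif_pos hex
      rw [hn]
      exact ⟨hex.choose_spec.1, hlt.trans h1, hex.choose_spec.2⟩
  refine ⟨fun s => F s.reverse, fun s a h => ⟨⟨((key s).2 h).1, fun hst he => ?_⟩, fun _ => ?_⟩⟩
  · have := (key s).1
    dsimp only at he
    rw [he] at this
    exact hs hst (List.prefix_nil.1 this)
  · dsimp only
    rw [hF]
    exact ⟨List.prefix_append _ _, by simp⟩

theorem exists_treeEmb (hS : ∀ s t, s <+: t → S t → S s) (h0 : S' [])
    (hle : treeRank S [] ≤ treeRank S' []) (hlt : strict → treeRank S [] < treeRank S' [])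
    (hfin : treeRank S [] < ⊤) : ∃ f, TreeEmb S S' strict f := by
  by_cases h : strict
  · obtain ⟨b, hb, hr⟩ := exists_child_of_lt_treeRank (hlt h)
    exact exists_treeEmb_of_root hS hb hr hfin (by simp)
  · exact exists_treeEmb_of_root hS h0 hle hfin (fun h' => absurd h' h)

theorem TreeEmb.prefix_append {f : List ℕ → List ℕ} (hf : TreeEmb S S' strict f)
    (hS : ∀ s t, s <+: t → S t → S s) (s u : List ℕ) (h : S (s ++ u)) :
    f s <+: f (s ++ u) ∧ (f s).length + u.length ≤ (f (s ++ u)).length := by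
  induction u using List.reverseRecOn with
  | nil => simp
  | append_singleton u a ih =>
    rw [← List.append_assoc] at h ⊢
    have h' := hS _ _ (List.prefix_append _ _) h
    obtain ⟨h1, h2⟩ := ih h'
    obtain ⟨h3, h4⟩ := (hf (s ++ u) a h').2 h
    refine ⟨h1.trans h3, ?_⟩
    simp only [List.length_append, List.length_singleton]
    omega

theorem exists_path_of_chain (hS : ∀ s t, s <+: t → S t → S s) {g : ℕ → List ℕ}
    (hg : ∀ n, S (g n)) (hp : ∀ n, g n <+: g (n + 1))
    (hl : ∀ n, (g n).length < (g (n + 1)).length) : ∃ y : Baire, ∀ k, S (pre y k) :=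
  ⟨chainLimit g, fun k => hS _ _ (pre_chainLimit_prefix hp hl k) (hg k)⟩

theorem TreeEmb.exists_path {f : List ℕ → List ℕ} (hf : TreeEmb S S' strict f)
    (hS' : ∀ s t, s <+: t → S' t → S' s) (h : ∃ y : Baire, ∀ k, S (pre y k)) :
    ∃ y : Baire, ∀ k, S' (pre y k) := by
  obtain ⟨y, hy⟩ := h
  have hstep : ∀ n, f (pre y n) <+: f (pre y (n + 1)) ∧
      (f (pre y n)).length < (f (pre y (n + 1))).length := fun n => by
    have h1 := hy (n + 1)
    rw [pre_succ] at h1 ⊢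
    exact (hf _ _ (hy n)).2 h1
  exact exists_path_of_chain hS' (g := fun n => f (pre y n)) (fun n => (hf _ 0 (hy n)).1.1)
    (fun n => (hstep n).1) (fun n => (hstep n).2)

/-- Mutually embeddable trees have a path as soon as one of the embeddings omits the root. -/
theorem TreeEmb.exists_path_of_mutual {f f' : List ℕ → List ℕ} {strict' : Prop}
    (hf : TreeEmb S S' strict f) (hf' : TreeEmb S' S strict' f') (hs : strict)
    (hS : ∀ s t, s <+: t → S t → S s) (hS' : ∀ s t, s <+: t → S' t → S' s) (h0 : S []) :
    ∃ y : Baire, ∀ k, S (pre y k) := by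
  have hmem : ∀ s, S s → S (f' (f s)) := fun s h => (hf' _ 0 (hf s 0 h).1.1).1.1
  have hmono : ∀ s t, s <+: t → S t → f' (f s) <+: f' (f t) ∧
      (s.length < t.length → (f' (f s)).length < (f' (f t)).length) := by
    rintro s _ ⟨u, rfl⟩ h
    obtain ⟨⟨w, hw⟩, h2⟩ := hf.prefix_append hS s u h
    have h3 : S' (f s ++ w) := by rw [hw]; exact (hf _ 0 h).1.1
    obtain ⟨h4, h5⟩ := hf'.prefix_append hS' _ _ h3
    rw [← hw] at h2 ⊢
    refine ⟨h4, fun hlt => ?_⟩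
    simp only [List.length_append] at h2 hlt
    omega
  have hit : ∀ n, S ((fun s => f' (f s))^[n] []) ∧
      (fun s => f' (f s))^[n] [] <+: (fun s => f' (f s))^[n + 1] [] ∧
      ((fun s => f' (f s))^[n] []).length < ((fun s => f' (f s))^[n + 1] []).length := by
    intro n
    induction n with
    | zero =>
      refine ⟨h0, List.nil_prefix, ?_⟩
      have hne : 0 < (f []).length := List.length_pos_iff.2 ((hf [] 0 h0).1.2 hs)
      have := (hf'.prefix_append hS' [] (f []) (hf [] 0 h0).1.1).2
      simp only [List.nil_append] at this
      simp only [Function.iterate_succ, Function.iterate_zero, Function.comp, id, List.length_nil]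
      omega
    | succ n ih =>
      obtain ⟨h1, h2, h3⟩ := ih
      have h4 := hmem _ h1
      rw [← Function.iterate_succ_apply' (fun s => f' (f s))] at h4
      have h5 := hmono _ _ h2 h4
      rw [← Function.iterate_succ_apply' (fun s => f' (f s)),
        ← Function.iterate_succ_apply' (fun s => f' (f s))] at h5
      exact ⟨h4, h5.1, h5.2 h3⟩
  exact exists_path_of_chain hS (fun n => (hit n).1) (fun n => (hit n).2.1) fun n => (hit n).2.2

end TreeEmb

/-! ### Closure properties of `Σ¹₁` predicates -/

/-- A predicate on a coded type is (lightface) `Σ¹₁`. -/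
def Sigma11Pred {α : Type} [Primcodable α] (p : α → Prop) : Prop :=
  ∃ R : α → List ℕ → Bool, Computable₂ R ∧ ∀ a, p a ↔ ∃ y : Baire, ∀ k, R a (pre y k) = true

namespace Sigma11Pred

variable {α β : Type} [Primcodable α] [Primcodable β]

theorem comp {p : β → Prop} (hp : Sigma11Pred p) {f : α → β} (hf : Computable f) :
    Sigma11Pred fun a => p (f a) := by
  obtain ⟨R, hR, h⟩ := hp
  exact ⟨fun a l => R (f a) l, hR.comp (hf.comp Computable.fst) Computable.snd, fun a => h (f a)⟩

theorem and_forall {p : α → Prop} (hp : Sigma11Pred p) {r : α → ℕ → Bool} (hr : Computable₂ r) :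
    Sigma11Pred fun a => p a ∧ ∀ n, r a n = true := by
  obtain ⟨R, hR, h⟩ := hp
  refine ⟨fun a l => R a l && r a l.length, Primrec.and.to_comp.comp hR
    (hr.comp Computable.fst (Computable.list_length.comp Computable.snd)), fun a => ?_⟩
  simp only [h, Bool.and_eq_true, pre_length]
  constructor
  · rintro ⟨⟨y, hy⟩, hn⟩
    exact ⟨y, fun k => ⟨hy k, hn k⟩⟩
  · rintro ⟨y, hy⟩
    exact ⟨⟨y, fun k => (hy k).1⟩, fun k => (hy k).2⟩

theorem exists_snd {p : α × β → Prop} (hp : Sigma11Pred p) :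
    Sigma11Pred fun a => ∃ b, p (a, b) := by
  obtain ⟨R, hR, h⟩ := hp
  let g : α × List ℕ → ℕ → Bool := fun q n =>
    Option.casesOn (Encodable.decode (α := β) n) false fun b => R (q.1, b) q.2.tail
  have hg : Computable₂ g := Computable.option_casesOn
    (Computable.decode.comp Computable.snd) (Computable.const false)
    (hR.comp ((Computable.fst.comp (Computable.fst.comp Computable.fst)).pair Computable.snd)
      (Primrec.list_tail.to_comp.comp (Computable.snd.comp (Computable.fst.comp Computable.fst))))
  refine ⟨fun a l => Option.casesOn l.head? true (g (a, l)), Computable.option_casesOn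
    (Primrec.list_head?.to_comp.comp Computable.snd) (Computable.const true) hg, fun a => ?_⟩
  constructor
  · rintro ⟨b, hb⟩
    obtain ⟨y, hy⟩ := (h _).1 hb
    refine ⟨fun i => Nat.casesOn i (Encodable.encode b) y, fun k => ?_⟩
    cases k with
    | zero => rfl
    | succ k => simpa [pre_succ', g] using hy k
  · rintro ⟨y, hy⟩
    have h1 := hy 1
    simp only [pre_succ', List.head?_cons, g] at h1
    cases hd : Encodable.decode (α := β) (y 0) with
    | none => simp [hd] at h1
    | some b =>
      refine ⟨b, (h _).2 ⟨fun i => y (i + 1), fun k => ?_⟩⟩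
      have h2 := hy (k + 1)
      simpa [pre_succ', g, hd] using h2

/-- A predicate of the form `∃ y, ∀ b, Q a b (y (i a b)) (y (j a b))` with computable data
is `Σ¹₁`. -/
theorem of_forall_two {Q : α × β → ℕ × ℕ → Bool} (hQ : Computable₂ Q) {i j : β → ℕ}
    (hi : Computable i) (hj : Computable j) :
    Sigma11Pred fun a => ∃ y : Baire, ∀ b, Q (a, b) (y (i b), y (j b)) = true := by
  let g₂ : ((α × List ℕ) × β) × ℕ → ℕ → Bool := fun q v => Q (q.1.1.1, q.1.2) (q.2, v)
  have hg₂ : Computable₂ g₂ := hQ.comp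
    ((Computable.fst.comp (Computable.fst.comp (Computable.fst.comp Computable.fst))).pair
      (Computable.snd.comp (Computable.fst.comp Computable.fst)))
    ((Computable.snd.comp Computable.fst).pair Computable.snd)
  let g₁ : (α × List ℕ) × β → ℕ → Bool := fun q u =>
    Option.casesOn (q.1.2[j q.2]?) true (g₂ (q, u))
  have hg₁ : Computable₂ g₁ := Computable.option_casesOn
    (Computable.list_getElem?.comp (Computable.snd.comp (Computable.fst.comp Computable.fst))
      (hj.comp (Computable.snd.comp Computable.fst))) (Computable.const true) hg₂
  let g₀ : α × List ℕ → β → Bool := fun q b =>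
    Option.casesOn (q.2[i b]?) true (g₁ (q, b))
  have hg₀ : Computable₂ g₀ := Computable.option_casesOn
    (Computable.list_getElem?.comp (Computable.snd.comp Computable.fst)
      (hi.comp Computable.snd)) (Computable.const true) hg₁
  refine ⟨fun a l => Option.casesOn (Encodable.decode (α := β) l.length.unpair.1) true
    (g₀ (a, l)), Computable.option_casesOn (Computable.decode.comp (Computable.fst.comp
      (Computable.unpair.comp (Computable.list_length.comp Computable.snd))))
      (Computable.const true) hg₀, fun a => exists_congr fun y => ?_⟩
  constructor
  · intro h k
    dsimp only
    rw [pre_length]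
    cases Encodable.decode (α := β) k.unpair.1 with
    | none => rfl
    | some b =>
      simp only [g₀, g₁, g₂]
      rcases lt_or_ge (i b) k with h1 | h1
      · rw [pre_getElem?_of_lt y h1]
        rcases lt_or_ge (j b) k with h2 | h2
        · rw [pre_getElem?_of_lt y h2]
          exact h b
        · rw [pre_getElem?_of_le y h2]
      · rw [pre_getElem?_of_le y h1]
  · intro h b
    have hk := h (Nat.pair (Encodable.encode b) (i b + j b + 1))
    have hle := Nat.right_le_pair (Encodable.encode b) (i b + j b + 1)
    dsimp only at hk
    rw [pre_length, Nat.unpair_pair, Encodable.encodek] at hk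
    simp only [g₀, g₁, g₂] at hk
    rwa [pre_getElem?_of_lt y (by omega), pre_getElem?_of_lt y (by omega)] at hk

/-- A `Σ¹₁` predicate is given by the paths of a uniformly computable family of trees. -/
theorem exists_tree {p : α → Prop} (hp : Sigma11Pred p) :
    ∃ R : α → List ℕ → Bool, Computable₂ R ∧ (∀ a, R a [] = true) ∧
      (∀ a s t, s <+: t → R a t = true → R a s = true) ∧
      ∀ a, p a ↔ ∃ y : Baire, ∀ k, R a (pre y k) = true := by
  obtain ⟨R, hR, h⟩ := hp
  let R' : α → List ℕ → Bool := fun a s =>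
    Nat.rec true (fun i acc => acc && R a (s.take i)) s.length
  have hR' : Computable₂ R' := by
    refine Computable.nat_rec (h := fun (q : α × List ℕ) (w : ℕ × Bool) =>
      w.2 && R q.1 (q.2.take w.1)) (Computable.list_length.comp Computable.snd)
      (Computable.const true) ?_
    exact Primrec.and.to_comp.comp (Computable.snd.comp Computable.snd)
      (hR.comp (Computable.fst.comp Computable.fst) (Primrec.list_take.to_comp.comp
        (Computable.fst.comp Computable.snd) (Computable.snd.comp Computable.fst)))
  have hiff : ∀ a s, R' a s = true ↔ ∀ i < s.length, R a (s.take i) = true := by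
    intro a s
    have : ∀ n, (Nat.rec true (fun i acc => acc && R a (s.take i)) n : Bool) = true ↔
        ∀ i < n, R a (s.take i) = true := by
      intro n
      induction n with
      | zero => simp
      | succ n ih => rw [Bool.and_eq_true, ih, Nat.forall_lt_succ_right]
    exact this _
  refine ⟨R', hR', fun a => rfl, ?_, fun a => ?_⟩
  · rintro a s _ ⟨u, rfl⟩ ht
    rw [hiff] at ht ⊢
    intro i hi
    have := ht i (by rw [List.length_append]; omega)
    rwa [List.take_append_of_le_length hi.le] at this
  · rw [h]
    refine exists_congr fun y => ⟨fun hy k => ?_, fun hy k => ?_⟩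
    · rw [hiff]
      intro i hi
      rw [pre_length] at hi
      rw [pre_take y hi.le]
      exact hy i
    · have := (hiff _ _).1 (hy (k + 1)) k (by rw [pre_length]; omega)
      rwa [pre_take y (Nat.le_succ k)] at this

end Sigma11Pred

/-! ### Uniformization of `Π¹₁` relations -/

/-- The finite sequence coded by a natural number. -/
def decodeList (n : ℕ) : List ℕ := (Encodable.decode (α := List ℕ) n).getD []

theorem decodeList_encode (s : List ℕ) : decodeList (Encodable.encode s) = s := by
  simp [decodeList]

theorem decodeList_computable : Computable decodeList :=
  Computable.option_getD Computable.decode (Computable.const [])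

theorem primrecPred_strictPrefix :
    PrimrecPred fun p : List ℕ × List ℕ => p.1 <+: p.2 ∧ p.1.length < p.2.length := by
  refine PrimrecPred.and ((Primrec.eq.comp Primrec.fst (Primrec.list_take.comp
    (Primrec.list_length.comp Primrec.fst) Primrec.snd)).of_eq fun p => ?_)
    (Primrec.nat_lt.comp (Primrec.list_length.comp Primrec.fst)
      (Primrec.list_length.comp Primrec.snd))
  exact List.prefix_iff_eq_take.symm

section Uniformization

variable {α β : Type} [Primcodable α] [Primcodable β]

theorem Sigma11Pred.forall_treeEmb {R : α × β → List ℕ → Bool} (hR : Computable₂ R) :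
    Sigma11Pred fun p : α × β => ∀ b', ∃ f, TreeEmb (fun s => R p s = true)
      (fun s => R (p.1, b') s = true) (Encodable.encode b' < Encodable.encode p.2) f := by
  let d₁ : (β × β) × List ℕ → Bool := fun z =>
    decide (¬ Encodable.encode z.1.1 < Encodable.encode z.1.2 ∨ z.2 ≠ [])
  let d₂ : List ℕ × List ℕ → Bool := fun z =>
    decide (z.1 <+: z.2 ∧ z.1.length < z.2.length)
  have hd₁ : Computable d₁ := (PrimrecPred.decide (((Primrec.nat_lt.comp
    (Primrec.encode.comp (Primrec.fst.comp Primrec.fst))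
    (Primrec.encode.comp (Primrec.snd.comp Primrec.fst))).not).or
      (Primrec.eq.comp Primrec.snd (Primrec.const [])).not)).to_comp.of_eq fun z => by
        simp only [d₁]
  have hd₂ : Computable d₂ := primrecPred_strictPrefix.decide.to_comp.of_eq fun z => by
    simp only [d₂]
  let Q : (α × β) × (β × List ℕ) × ℕ → ℕ × ℕ → Bool := fun q uv =>
    !R q.1 q.2.1.2 ||
      ((R (q.1.1, q.2.1.1) (decodeList uv.1) &&
        d₁ ((q.2.1.1, q.1.2), decodeList uv.1)) &&
      (!R q.1 (q.2.1.2 ++ [q.2.2]) || d₂ (decodeList uv.1, decodeList uv.2)))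
  have hQ : Computable₂ Q := by
    have hp : Computable fun z : ((α × β) × (β × List ℕ) × ℕ) × ℕ × ℕ => z.1.1 :=
      Computable.fst.comp Computable.fst
    have hb : Computable fun z : ((α × β) × (β × List ℕ) × ℕ) × ℕ × ℕ => z.1.2.1.1 :=
      Computable.fst.comp (Computable.fst.comp (Computable.snd.comp Computable.fst))
    have hs : Computable fun z : ((α × β) × (β × List ℕ) × ℕ) × ℕ × ℕ => z.1.2.1.2 :=
      Computable.snd.comp (Computable.fst.comp (Computable.snd.comp Computable.fst))
    have hn : Computable fun z : ((α × β) × (β × List ℕ) × ℕ) × ℕ × ℕ => z.1.2.2 :=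
      Computable.snd.comp (Computable.snd.comp Computable.fst)
    have hu : Computable fun z : ((α × β) × (β × List ℕ) × ℕ) × ℕ × ℕ => decodeList z.2.1 :=
      decodeList_computable.comp (Computable.fst.comp Computable.snd)
    have hv : Computable fun z : ((α × β) × (β × List ℕ) × ℕ) × ℕ × ℕ => decodeList z.2.2 :=
      decodeList_computable.comp (Computable.snd.comp Computable.snd)
    have hor : Computable₂ or := Primrec.or.to_comp
    have hand : Computable₂ and := Primrec.and.to_comp
    have hnot : Computable not := Primrec.not.to_comp
    have h₁ : Computable fun z : ((α × β) × (β × List ℕ) × ℕ) × ℕ × ℕ => R z.1.1 z.1.2.1.2 :=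
      hR.comp hp hs
    have h₂ : Computable fun z : ((α × β) × (β × List ℕ) × ℕ) × ℕ × ℕ =>
        R (z.1.1.1, z.1.2.1.1) (decodeList z.2.1) :=
      hR.comp ((Computable.fst.comp hp).pair hb) hu
    have h₃ : Computable fun z : ((α × β) × (β × List ℕ) × ℕ) × ℕ × ℕ =>
        d₁ ((z.1.2.1.1, z.1.1.2), decodeList z.2.1) :=
      hd₁.comp ((hb.pair (Computable.snd.comp hp)).pair hu)
    have h₄ : Computable fun z : ((α × β) × (β × List ℕ) × ℕ) × ℕ × ℕ =>
        R z.1.1 (z.1.2.1.2 ++ [z.1.2.2]) :=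
      hR.comp hp (Computable.list_concat.comp hs hn)
    have h₅ : Computable fun z : ((α × β) × (β × List ℕ) × ℕ) × ℕ × ℕ =>
        d₂ (decodeList z.2.1, decodeList z.2.2) :=
      hd₂.comp (hu.pair hv)
    exact hor.comp (hnot.comp h₁) (hand.comp (hand.comp h₂ h₃) (hor.comp (hnot.comp h₄) h₅))
  have hi : Computable fun b : (β × List ℕ) × ℕ => Encodable.encode b.1 :=
    Computable.encode.comp Computable.fst
  have hj : Computable fun b : (β × List ℕ) × ℕ => Encodable.encode (b.1.1, b.1.2 ++ [b.2]) :=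
    Computable.encode.comp ((Computable.fst.comp Computable.fst).pair
      (Computable.list_concat.comp (Computable.snd.comp Computable.fst) Computable.snd))
  have hQiff : ∀ p b' s n u v, Q (p, (b', s), n) (u, v) = true ↔ (R p s = true →
      (R (p.1, b') (decodeList u) = true ∧
        (Encodable.encode b' < Encodable.encode p.2 → decodeList u ≠ [])) ∧
      (R p (s ++ [n]) = true → decodeList u <+: decodeList v ∧
        (decodeList u).length < (decodeList v).length)) := by
    intro p b' s n u v
    simp only [Q, d₁, d₂, Bool.or_eq_true, Bool.and_eq_true, Bool.not_eq_true', decide_eq_true_eq,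
      ← Bool.not_eq_true, imp_iff_not_or]
  obtain ⟨R₁, hR₁, h⟩ := Sigma11Pred.of_forall_two hQ hi hj
  refine ⟨R₁, hR₁, fun p => Iff.trans ?_ (h p)⟩
  constructor
  · intro hf
    choose f hf using hf
    let y : Baire := fun n => Option.casesOn (Encodable.decode (α := β × List ℕ) n) 0
      fun q => Encodable.encode (f q.1 q.2)
    have hy : ∀ b' s, decodeList (y (Encodable.encode (b', s))) = f b' s := fun b' s => by
      simp only [y, Encodable.encodek, decodeList_encode]
    refine ⟨y, ?_⟩
    rintro ⟨⟨b', s⟩, n⟩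
    rw [hQiff, hy, hy]
    exact hf b' s n
  · rintro ⟨y, hy⟩ b'
    refine ⟨fun s => decodeList (y (Encodable.encode (b', s))), fun s n => ?_⟩
    exact (hQiff _ _ _ _ _ _).1 (hy ((b', s), n))

/-- Uniformization of total `Π¹₁` relations: the complement of a `Σ¹₁` relation with nonempty
sections has a uniformizing function with `Σ¹₁` graph. -/
theorem Sigma11Pred.exists_uniformization {p : α × β → Prop} (hp : Sigma11Pred p)
    (hex : ∀ a, ∃ b, ¬ p (a, b)) :
    ∃ u : α → β, (∀ a, ¬ p (a, u a)) ∧ Sigma11Pred fun q : α × β => q.2 = u q.1 := by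
  obtain ⟨R, hR, h0, hpre, hiff⟩ := hp.exists_tree
  let S : α → β → List ℕ → Prop := fun a b s => R (a, b) s = true
  have hfin : ∀ a b, treeRank (S a b) [] < ⊤ ↔ ¬ p (a, b) := fun a b => by
    rw [treeRank_lt_top, acc_childRel_nil_iff (h0 _), hiff]
  let key : α → β → WithTop Ordinal.{0} ×ₗ ℕ := fun a b =>
    toLex (treeRank (S a b) [], Encodable.encode b)
  have hmin : ∀ a, ∃ b, ∀ b', key a b ≤ key a b' := fun a => by
    obtain ⟨b₀, _⟩ := hex a
    have : Nonempty β := ⟨b₀⟩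
    exact ⟨Function.argmin (key a), fun b' => Function.argmin_le (key a) b'⟩
  choose u hu using hmin
  have hle : ∀ a b', treeRank (S a (u a)) [] ≤ treeRank (S a b') [] := fun a b' => by
    rcases Prod.Lex.le_iff.1 (hu a b') with h | h
    · exact h.le
    · exact h.1.le
  have hlt : ∀ a b', Encodable.encode b' < Encodable.encode (u a) →
      treeRank (S a (u a)) [] < treeRank (S a b') [] := fun a b' hb => by
    rcases Prod.Lex.le_iff.1 (hu a b') with h | h
    · exact h
    · exact absurd hb (not_lt.2 h.2)
  have hup : ∀ a, treeRank (S a (u a)) [] < ⊤ := fun a => by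
    obtain ⟨b₀, hb₀⟩ := hex a
    exact (hle a b₀).trans_lt ((hfin a b₀).2 hb₀)
  have hemb : ∀ a b', ∃ f, TreeEmb (S a (u a)) (S a b')
      (Encodable.encode b' < Encodable.encode (u a)) f := fun a b' =>
    exists_treeEmb (hpre _) (h0 _) (hle a b') (hlt a b') (hup a)
  refine ⟨u, fun a => (hfin a _).1 (hup a), ?_⟩
  obtain ⟨R₁, hR₁, h₁⟩ := Sigma11Pred.forall_treeEmb hR
  refine ⟨R₁, hR₁, fun q => Iff.trans ?_ (h₁ q)⟩
  obtain ⟨a, b⟩ := q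
  constructor
  · intro hb
    change b = u a at hb
    subst hb
    exact hemb a
  · intro hb
    have hnp : ¬ p (a, u a) := (hfin a _).1 (hup a)
    obtain ⟨f, hf⟩ := hb (u a)
    obtain ⟨f', hf'⟩ := hemb a b
    change b = u a
    by_contra hne
    rcases lt_trichotomy (Encodable.encode (u a)) (Encodable.encode b) with h | h | h
    · exact hnp ((hiff _).2 (hf.exists_path (hpre _)
        (hf.exists_path_of_mutual hf' h (hpre _) (hpre _) (h0 _))))
    · exact hne (Encodable.encode_injective h).symm
    · exact hnp ((hiff _).2 (hf'.exists_path_of_mutual hf h (hpre _) (hpre _) (h0 _)))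

end Uniformization

/-! ### Universal search -/

theorem PrimrecPred.exists_computable₂ {α β : Type} [Primcodable α] [Primcodable β]
    {p : α × β → Prop} (hp : PrimrecPred p) :
    ∃ h : α → β → Bool, Computable₂ h ∧ ∀ a b, h a b = true ↔ p (a, b) := by
  obtain ⟨_, hp⟩ := hp
  exact ⟨fun a b => decide (p (a, b)), hp.to_comp, fun a b => decide_eq_true_iff⟩

/-- A total relation that is decidable has a computable selector. -/
theorem exists_computable_selector {α β : Type} [Primcodable α] [Primcodable β]
    {h : α → β → Bool} (hh : Computable₂ h) (hex : ∀ a, ∃ b, h a b = true) :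
    ∃ g : α → β, Computable g ∧ ∀ a, h a (g a) = true := by
  let f : α → ℕ → Option β := fun a n => (Encodable.decode (α := β) n).bind fun b =>
    bif h a b then some b else none
  have hf : Computable₂ f := Computable.option_bind (Computable.decode.comp Computable.snd)
    (Computable.cond (hh.comp (Computable.fst.comp Computable.fst) Computable.snd)
      (Computable.option_some.comp Computable.snd) (Computable.const none))
  have hdom : ∀ a, (Nat.rfindOpt (f a)).Dom := fun a => by
    obtain ⟨b, hb⟩ := hex a
    refine Nat.rfindOpt_dom.2 ⟨Encodable.encode b, b, ?_⟩
    simp [f, Encodable.encodek, hb]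
  refine ⟨fun a => (Nat.rfindOpt (f a)).get (hdom a),
    (Partrec.rfindOpt hf).of_eq_tot fun a => Part.get_mem _, fun a => ?_⟩
  obtain ⟨n, hn⟩ := Nat.rfindOpt_spec (Part.get_mem (hdom a))
  obtain ⟨b, -, hb⟩ := Option.bind_eq_some_iff.1 hn
  cases hab : h a b with
  | false => simp [hab] at hb
  | true =>
    rw [hab] at hb
    have hb' : b = (Nat.rfindOpt (f a)).get (hdom a) := Option.some.inj hb
    exact hb'.subst (motive := fun b => h a b = true) hab

/-! ### Simulating programs on finite sequences -/

/-- The output of the `k`-th program on the finite sequence `σ` within `s` steps. -/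
def runList (k s : ℕ) (σ : List ℕ) : Option (List ℕ) :=
  (Nat.Partrec.Code.evaln s (Denumerable.ofNat Nat.Partrec.Code k) (Encodable.encode σ)).bind
    Encodable.decode

theorem runList_primrec : Primrec fun z : (ℕ × ℕ) × List ℕ => runList z.1.1 z.1.2 z.2 :=
  Primrec.option_bind (Nat.Partrec.Code.primrec_evaln.comp
    (((Primrec.snd.comp Primrec.fst).pair ((Primrec.ofNat _).comp
      (Primrec.fst.comp Primrec.fst))).pair (Primrec.encode.comp Primrec.snd)))
    (Primrec.decode.comp Primrec.snd)

theorem runList_mono {k s s' : ℕ} (h : s ≤ s') {σ v : List ℕ} (hv : runList k s σ = some v) :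
    runList k s' σ = some v := by
  obtain ⟨n, hn, hd⟩ := Option.bind_eq_some_iff.1 hv
  exact Option.bind_eq_some_iff.2 ⟨n, Nat.Partrec.Code.evaln_mono h hn, hd⟩

theorem runList_unique {k s s' : ℕ} {σ v v' : List ℕ} (hv : runList k s σ = some v)
    (hv' : runList k s' σ = some v') : v = v' :=
  Option.some.inj ((runList_mono (le_max_left s s') hv).symm.trans
    (runList_mono (le_max_right s s') hv'))

theorem exists_runList {φ : List ℕ → List ℕ} (hφ : Computable φ) :
    ∃ k, ∀ σ, ∃ s, runList k s σ = some (φ σ) := by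
  obtain ⟨c, hc⟩ := Nat.Partrec.Code.exists_code.1 hφ
  refine ⟨Encodable.encode c, fun σ => ?_⟩
  have hm : Encodable.encode (φ σ) ∈ c.eval (Encodable.encode σ) := by
    rw [hc]
    simp
  obtain ⟨s, hs⟩ := Nat.Partrec.Code.evaln_complete.1 hm
  refine ⟨s, Option.bind_eq_some_iff.2 ⟨_, ?_, Encodable.encodek _⟩⟩
  rwa [Denumerable.ofNat_encode]

/-- `ExtendsOutput (k, τ) (τ', s, v, v')`: within `s` steps the `k`-th program outputs `v` on
`k :: τ` and a strictly longer extension `v'` of `v` on the extension `k :: τ'` of `k :: τ`. -/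
def ExtendsOutput (q : ℕ × List ℕ) (w : List ℕ × ℕ × List ℕ × List ℕ) : Prop :=
  q.2 <+: w.1 ∧ runList q.1 w.2.1 (q.1 :: q.2) = some w.2.2.1 ∧
    runList q.1 w.2.1 (q.1 :: w.1) = some w.2.2.2 ∧
      w.2.2.1 <+: w.2.2.2 ∧ w.2.2.1.length < w.2.2.2.length

theorem exists_computable_extendsOutput :
    ∃ h : ℕ × List ℕ → List ℕ × ℕ × List ℕ × List ℕ → Bool, Computable₂ h ∧
      ∀ q w, h q w = true ↔ ExtendsOutput q w := by
  have hk : Primrec fun z : (ℕ × List ℕ) × List ℕ × ℕ × List ℕ × List ℕ => z.1.1 :=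
    Primrec.fst.comp Primrec.fst
  have hτ : Primrec fun z : (ℕ × List ℕ) × List ℕ × ℕ × List ℕ × List ℕ => z.1.2 :=
    Primrec.snd.comp Primrec.fst
  have hτ' : Primrec fun z : (ℕ × List ℕ) × List ℕ × ℕ × List ℕ × List ℕ => z.2.1 :=
    Primrec.fst.comp Primrec.snd
  have hs : Primrec fun z : (ℕ × List ℕ) × List ℕ × ℕ × List ℕ × List ℕ => z.2.2.1 :=
    Primrec.fst.comp (Primrec.snd.comp Primrec.snd)
  have hv : Primrec fun z : (ℕ × List ℕ) × List ℕ × ℕ × List ℕ × List ℕ => z.2.2.2.1 :=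
    Primrec.fst.comp (Primrec.snd.comp (Primrec.snd.comp Primrec.snd))
  have hv' : Primrec fun z : (ℕ × List ℕ) × List ℕ × ℕ × List ℕ × List ℕ => z.2.2.2.2 :=
    Primrec.snd.comp (Primrec.snd.comp (Primrec.snd.comp Primrec.snd))
  have h₁ : PrimrecPred fun z : (ℕ × List ℕ) × List ℕ × ℕ × List ℕ × List ℕ =>
      z.1.2 <+: z.2.1 := (Primrec.eq.comp hτ (Primrec.list_take.comp
        (Primrec.list_length.comp hτ) hτ')).of_eq fun z => List.prefix_iff_eq_take.symm
  have h₂ : PrimrecPred fun z : (ℕ × List ℕ) × List ℕ × ℕ × List ℕ × List ℕ =>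
      runList z.1.1 z.2.2.1 (z.1.1 :: z.1.2) = some z.2.2.2.1 :=
    Primrec.eq.comp (runList_primrec.comp ((hk.pair hs).pair (Primrec.list_cons.comp hk hτ)))
      (Primrec.option_some.comp hv)
  have h₃ : PrimrecPred fun z : (ℕ × List ℕ) × List ℕ × ℕ × List ℕ × List ℕ =>
      runList z.1.1 z.2.2.1 (z.1.1 :: z.2.1) = some z.2.2.2.2 :=
    Primrec.eq.comp (runList_primrec.comp ((hk.pair hs).pair (Primrec.list_cons.comp hk hτ')))
      (Primrec.option_some.comp hv')
  have h₄ : PrimrecPred fun z : (ℕ × List ℕ) × List ℕ × ℕ × List ℕ × List ℕ =>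
      z.2.2.2.1 <+: z.2.2.2.2 ∧ z.2.2.2.1.length < z.2.2.2.2.length :=
    primrecPred_strictPrefix.comp (hv.pair hv')
  exact (h₁.and (h₂.and (h₃.and h₄))).exists_computable₂

/-- The `Σ¹₁` event that the output of the `k`-th program on `k :: τ` is in `T` and can be
extended. -/
theorem sigma11Pred_extendsOutput {T : Set (List ℕ)} (hT : Sigma11List T) :
    Sigma11Pred fun q : ℕ × List ℕ => ∃ w, w.2.2.1 ∈ T ∧ ExtendsOutput q w := by
  obtain ⟨h, hh, hiff⟩ := exists_computable_extendsOutput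
  have hmem : Sigma11Pred fun v : List ℕ => v ∈ T := hT
  have hc : Computable fun z : (ℕ × List ℕ) × List ℕ × ℕ × List ℕ × List ℕ => z.2.2.2.1 :=
    Computable.fst.comp (Computable.snd.comp (Computable.snd.comp Computable.snd))
  have hr : Computable₂ fun (z : (ℕ × List ℕ) × List ℕ × ℕ × List ℕ × List ℕ) (_ : ℕ) =>
      h z.1 z.2 := hh.comp (Computable.fst.comp Computable.fst) (Computable.snd.comp Computable.fst)
  obtain ⟨R, hR, hp⟩ := ((hmem.comp hc).and_forall hr).exists_snd
  refine ⟨R, hR, fun q => (exists_congr fun w => ?_).trans (hp q)⟩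
  rw [← hiff, forall_const]

/-- If every `k :: τ` had an extendible output in `T`, iterating a search for extensions would
give a computable path of `T`. -/
theorem exists_not_extendsOutput {T : Set (List ℕ)} (hT : IsTree T)
    (hcomp : ∀ x ∈ paths T, ¬ Computable x) (k : ℕ) :
    ∃ τ, ¬ ∃ w, w.2.2.1 ∈ T ∧ ExtendsOutput (k, τ) w := by
  by_contra! hall
  obtain ⟨h, hh, hiff⟩ := exists_computable_extendsOutput
  obtain ⟨g, hg, hgs⟩ := exists_computable_selector (h := fun (τ : List ℕ) w => h (k, τ) w)
    (hh.comp ((Computable.const k).pair Computable.fst) Computable.snd) fun τ => by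
      obtain ⟨w, -, hw⟩ := hall τ
      exact ⟨w, (hiff _ _).2 hw⟩
  have hge : ∀ τ, ExtendsOutput (k, τ) (g τ) := fun τ => (hiff _ _).1 (hgs τ)
  have hgT : ∀ τ, (g τ).2.2.1 ∈ T := fun τ => by
    obtain ⟨w, hwT, -, hw, -⟩ := hall τ
    rwa [runList_unique (hge τ).2.1 hw]
  let t : ℕ → List ℕ := fun j => Nat.rec [] (fun _ τ => (g τ).1) j
  have ht : Computable t := Computable.nat_rec Computable.id (Computable.const [])
    (Computable.fst.comp (hg.comp (Computable.snd.comp Computable.snd))).to₂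
  let v : ℕ → List ℕ := fun j => (g (t j)).2.2.1
  have hv : Computable v :=
    Computable.fst.comp (Computable.snd.comp (Computable.snd.comp (hg.comp ht)))
  have hvs : ∀ j, v (j + 1) = (g (t j)).2.2.2 := fun j =>
    runList_unique (hge (t (j + 1))).2.1 (hge (t j)).2.2.1
  have hp : ∀ j, v j <+: v (j + 1) := fun j => by
    rw [hvs]
    exact (hge (t j)).2.2.2.1
  have hl : ∀ j, (v j).length < (v (j + 1)).length := fun j => by
    rw [hvs]
    exact (hge (t j)).2.2.2.2
  refine hcomp (chainLimit v) (fun n => hT _ (hgT (t n)) _ (pre_chainLimit_prefix hp hl n)) ?_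
  exact (Primrec.list_getD 0).to_comp.comp (hv.comp Computable.succ) Computable.id

/-! ### Diagonal extensions -/

theorem getElem?_of_prefix {s t : List ℕ} (h : s <+: t) {i v : ℕ} (hv : s[i]? = some v) :
    t[i]? = some v := by
  obtain ⟨r, rfl⟩ := h
  rwa [List.getElem?_append_left (List.getElem?_eq_some_iff.1 hv).1]

/-- `v` is an admissible value at position `i` of a sequence which begins with `τ` and is
diagonally noncomputable from then on. -/
def Admissible (τ : List ℕ) (i v : ℕ) : Prop :=
  (i < τ.length → τ[i]? = some v) ∧
    (τ.length ≤ i → v ∉ (Denumerable.ofNat Nat.Partrec.Code i.unpair.1).eval i)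

theorem exists_admissible (τ : List ℕ) (i : ℕ) : ∃ v, Admissible τ i v := by
  rcases lt_or_ge i τ.length with h | h
  · exact ⟨τ[i], fun _ => List.getElem?_eq_getElem h, fun h' => absurd h h'.not_gt⟩
  · by_cases h0 : 0 ∈ (Denumerable.ofNat Nat.Partrec.Code i.unpair.1).eval i
    · exact ⟨1, fun h' => absurd h h'.not_ge, fun _ h1 => zero_ne_one (Part.mem_unique h0 h1)⟩
    · exact ⟨0, fun h' => absurd h h'.not_ge, fun _ => h0⟩

theorem exists_computable_admissible :
    ∃ r : List ℕ × List ℕ → ℕ → Bool, Computable₂ r ∧ ∀ τ σ,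
      (∀ n, r (τ, σ) n = true) ↔ ∀ i v, σ[i]? = some v → Admissible τ i v := by
  have hi : Primrec fun z : (List ℕ × List ℕ) × ℕ => z.2.unpair.1 :=
    Primrec.fst.comp (Primrec.unpair.comp Primrec.snd)
  have hs : Primrec fun z : (List ℕ × List ℕ) × ℕ => z.2.unpair.2 :=
    Primrec.snd.comp (Primrec.unpair.comp Primrec.snd)
  have hτ : Primrec fun z : (List ℕ × List ℕ) × ℕ => z.1.1[z.2.unpair.1]? :=
    Primrec.list_getElem?.comp (Primrec.fst.comp Primrec.fst) hi
  have hσ : Primrec fun z : (List ℕ × List ℕ) × ℕ => z.1.2[z.2.unpair.1]? :=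
    Primrec.list_getElem?.comp (Primrec.snd.comp Primrec.fst) hi
  have hl : Primrec fun z : (List ℕ × List ℕ) × ℕ => z.1.1.length :=
    Primrec.list_length.comp (Primrec.fst.comp Primrec.fst)
  have he : Primrec fun z : (List ℕ × List ℕ) × ℕ => Nat.Partrec.Code.evaln z.2.unpair.2
      (Denumerable.ofNat Nat.Partrec.Code z.2.unpair.1.unpair.1) z.2.unpair.1 :=
    Nat.Partrec.Code.primrec_evaln.comp ((hs.pair ((Primrec.ofNat _).comp
      (Primrec.fst.comp (Primrec.unpair.comp hi)))).pair hi)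
  have h₁ : PrimrecPred fun z : (List ℕ × List ℕ) × ℕ => z.1.2[z.2.unpair.1]? = none :=
    Primrec.eq.comp hσ (Primrec.const none)
  have h₂ : PrimrecPred fun z : (List ℕ × List ℕ) × ℕ =>
      z.1.1[z.2.unpair.1]? = z.1.2[z.2.unpair.1]? := Primrec.eq.comp hτ hσ
  have h₃ : PrimrecPred fun z : (List ℕ × List ℕ) × ℕ => z.1.1.length ≤ z.2.unpair.1 :=
    Primrec.nat_le.comp hl hi
  have h₄ : PrimrecPred fun z : (List ℕ × List ℕ) × ℕ => ¬ Nat.Partrec.Code.evaln z.2.unpair.2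
      (Denumerable.ofNat Nat.Partrec.Code z.2.unpair.1.unpair.1) z.2.unpair.1 =
        z.1.2[z.2.unpair.1]? := (Primrec.eq.comp he hσ).not
  obtain ⟨r, hr, hiff⟩ := (h₁.or (h₂.or (h₃.and h₄))).exists_computable₂
  refine ⟨r, hr, fun τ σ => ?_⟩
  simp only [hiff]
  constructor
  · intro h i v hv
    refine ⟨fun hi => ?_, fun hi hm => ?_⟩
    · have := h (Nat.pair i 0)
      simp only [Nat.unpair_pair, hv, reduceCtorEq, false_or] at this
      exact this.resolve_right fun h' => absurd hi h'.1.not_gt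
    · obtain ⟨s, hs⟩ := Nat.Partrec.Code.evaln_complete.1 hm
      have := h (Nat.pair i s)
      simp only [Nat.unpair_pair, hv, reduceCtorEq, false_or,
        List.getElem?_eq_none hi] at this
      exact this.2 hs
  · intro h n
    cases hv : σ[n.unpair.1]? with
    | none => exact Or.inl rfl
    | some v =>
      obtain ⟨ha, hb⟩ := h _ v hv
      rcases lt_or_ge n.unpair.1 τ.length with hn | hn
      · exact Or.inr (Or.inl (ha hn))
      · exact Or.inr (Or.inr ⟨hn, fun he => hb hn (Nat.Partrec.Code.evaln_sound he)⟩)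

/-- The tree whose paths are the sequences `k :: z` where `z` begins with `u k` and is
diagonally noncomputable from then on. -/
def diagTree (u : ℕ → List ℕ) : Set (List ℕ) :=
  {ρ | ∀ i v, ρ.tail[i]? = some v → Admissible (u ρ.headI) i v}

theorem isTree_diagTree (u : ℕ → List ℕ) : IsTree (diagTree u) := by
  rintro _ hσ τ ⟨s, rfl⟩
  cases τ with
  | nil => simp [diagTree]
  | cons a τ => exact fun i v hv => hσ i v (getElem?_of_prefix (List.prefix_append τ s) hv)

theorem sigma11List_diagTree {u : ℕ → List ℕ}
    (hu : Sigma11Pred fun q : ℕ × List ℕ => q.2 = u q.1) : Sigma11List (diagTree u) := by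
  obtain ⟨r, hr, hiff⟩ := exists_computable_admissible
  have hc : Computable fun z : List ℕ × List ℕ => (z.1.headI, z.2) :=
    (Primrec.list_headI.to_comp.comp Computable.fst).pair Computable.snd
  have hr' : Computable₂ fun (z : List ℕ × List ℕ) (n : ℕ) => r (z.2, z.1.tail) n :=
    hr.comp ((Computable.snd.comp Computable.fst).pair
      (Primrec.list_tail.to_comp.comp (Computable.fst.comp Computable.fst))) Computable.snd
  obtain ⟨R, hR, hp⟩ := ((hu.comp hc).and_forall hr').exists_snd
  refine ⟨R, hR, fun ρ => Iff.trans ?_ (hp ρ)⟩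
  simp only [hiff, exists_eq_left]
  rfl

theorem mem_paths_diagTree {u : ℕ → List ℕ} {x : Baire} :
    x ∈ paths (diagTree u) ↔ ∀ i, Admissible (u (x 0)) i (x (i + 1)) := by
  constructor
  · intro h i
    have := h (i + 2)
    rw [pre_succ'] at this
    exact this i _ (pre_getElem?_of_lt (fun i => x (i + 1)) (Nat.lt_succ_self i))
  · intro h n
    cases n with
    | zero => simp [diagTree, pre_zero]
    | succ n =>
      rw [pre_succ']
      intro i v hv
      rw [List.tail_cons] at hv
      have hi : i < n := by
        by_contra hi
        rw [pre_getElem?_of_le _ (not_lt.1 hi)] at hv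
        cases hv
      rw [pre_getElem?_of_lt _ hi] at hv
      rw [← Option.some.inj hv]
      exact h i

theorem exists_mem_paths_diagTree (u : ℕ → List ℕ) (k : ℕ) :
    ∃ x ∈ paths (diagTree u), pre x ((u k).length + 1) = k :: u k := by
  choose d hd using exists_admissible (u k)
  refine ⟨fun n => Nat.casesOn n k d, mem_paths_diagTree.2 hd, ?_⟩
  rw [pre_succ']
  refine congrArg (k :: ·) (Eq.symm ?_)
  refine pre_eq_of_forall_getElem? fun i v hv => ?_
  have hi := (List.getElem?_eq_some_iff.1 hv).1
  exact Option.some.inj (hv.symm.trans ((hd i).1 hi))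

theorem not_computable_of_mem_paths_diagTree {u : ℕ → List ℕ} {x : Baire}
    (hx : x ∈ paths (diagTree u)) : ¬ Computable x := by
  intro hc
  have hz : Computable fun i => x (i + 1) := hc.comp Computable.succ
  obtain ⟨c, hc⟩ := Nat.Partrec.Code.exists_code.1 (Partrec.nat_iff.1 hz)
  refine (mem_paths_diagTree.1 hx (Nat.pair (Encodable.encode c) (u (x 0)).length)).2
    (Nat.right_le_pair _ _) ?_
  rw [Nat.unpair_pair, Denumerable.ofNat_encode, hc]
  exact Part.mem_some _

/-! ### Turing functionals -/

namespace TuringFunctional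

/-- The identity functional. -/
protected def id : TuringFunctional where
  φ := fun σ => σ
  computable := Computable.id
  mono := fun _ _ h => h

theorem eval_id (x : Baire) : TuringFunctional.id.Eval x x := fun n =>
  ⟨n + 1, pre_getElem?_of_lt x n.lt_succ_self⟩

variable {Φ : TuringFunctional} {x y : Baire}

theorem pre_mono {m n : ℕ} (h : m ≤ n) : Φ.φ (pre x m) <+: Φ.φ (pre x n) :=
  Φ.mono _ _ (pre_prefix x h)

theorem Eval.eq_of_getElem? (h : Φ.Eval x y) {m n v : ℕ} (hv : (Φ.φ (pre x m))[n]? = some v) :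
    v = y n := by
  obtain ⟨m', hm'⟩ := h n
  have h₁ := getElem?_of_prefix (pre_mono (Φ := Φ) (x := x) (le_max_left m m')) hv
  have h₂ := getElem?_of_prefix (pre_mono (Φ := Φ) (x := x) (le_max_right m m')) hm'
  exact Option.some.inj (h₁.symm.trans h₂)

theorem Eval.eq_pre (h : Φ.Eval x y) (m : ℕ) :
    Φ.φ (pre x m) = pre y (Φ.φ (pre x m)).length :=
  pre_eq_of_forall_getElem? fun _ _ hv => h.eq_of_getElem? hv

/-- Turing functionals map computable points to computable points. -/
theorem Eval.computable (h : Φ.Eval x y) (hx : Computable x) : Computable y := by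
  have hc : Computable₂ fun n m : ℕ => (Φ.φ (pre x m))[n]? := Computable.list_getElem?.comp
    (Φ.computable.comp ((pre_computable hx).comp Computable.snd)) Computable.fst
  refine (Partrec.rfindOpt hc).of_eq_tot fun n => ?_
  obtain ⟨m, hm⟩ := h n
  obtain ⟨v, hv⟩ := Part.dom_iff_mem.1
    (Nat.rfindOpt_dom (f := fun m => (Φ.φ (pre x m))[n]?).2 ⟨m, y n, hm⟩)
  obtain ⟨m', hm'⟩ := Nat.rfindOpt_spec hv
  rwa [← h.eq_of_getElem? hm']

end TuringFunctional

theorem medvedevLE_of_superset {P Q : Set Baire} (h : Q ⊆ P) : MedvedevLE P Q :=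
  ⟨TuringFunctional.id, fun x hx => ⟨x, h hx, TuringFunctional.eval_id x⟩⟩

theorem not_medvedevLE_univ {P : Set Baire} (hP : ∀ x ∈ P, ¬ Computable x) :
    ¬ MedvedevLE P univ := by
  rintro ⟨Φ, hΦ⟩
  obtain ⟨y, hy, he⟩ := hΦ (fun _ => 0) (mem_univ _)
  exact hP y hy (he.computable (Computable.const 0))

theorem not_medvedevLE_diagTree {T : Set (List ℕ)} {u : ℕ → List ℕ}
    (hu : ∀ k, ¬ ∃ w, w.2.2.1 ∈ T ∧ ExtendsOutput (k, u k) w) :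
    ¬ MedvedevLE (paths T) (paths (diagTree u)) := by
  rintro ⟨Φ, hΦ⟩
  obtain ⟨k, hk⟩ := exists_runList Φ.computable
  obtain ⟨x, hx, hxk⟩ := exists_mem_paths_diagTree u k
  obtain ⟨y, hy, he⟩ := hΦ x hx
  have hw := he.eq_pre ((u k).length + 1)
  rw [hxk] at hw
  obtain ⟨m, hm⟩ := he (Φ.φ (k :: u k)).length
  let M := max m ((u k).length + 1)
  have hpre : k :: u k <+: pre x M := hxk ▸ pre_prefix x (le_max_right _ _)
  have hlen : (Φ.φ (k :: u k)).length < (Φ.φ (pre x M)).length :=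
    (List.getElem?_eq_some_iff.1 hm).1.trans_le
      (TuringFunctional.pre_mono (le_max_left _ _)).length_le
  obtain ⟨t, ht⟩ := hpre
  rw [List.cons_append] at ht
  rw [← ht] at hlen
  obtain ⟨s, hs⟩ := hk (k :: u k)
  obtain ⟨s', hs'⟩ := hk (k :: (u k ++ t))
  refine hu k ⟨(u k ++ t, max s s', Φ.φ (k :: u k), Φ.φ (k :: (u k ++ t))), ?_,
    List.prefix_append _ _, runList_mono (le_max_left _ _) hs,
    runList_mono (le_max_right _ _) hs', Φ.mono _ _ ⟨t, rfl⟩, hlen⟩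
  rw [hw]
  exact hy _

/-- Downward density above the trivial degree for nonempty `Σ¹₁` closed sets:
below any nonempty `Σ¹₁` closed set `A` with no computable member there is a
nonempty `Σ¹₁` closed set `B` with `ℕ^ℕ <_M A ∪ B <_M A`. -/
theorem sigma11_closed_downward_dense :
    ∀ T : Set (List ℕ), IsTree T → Sigma11List T → (paths T).Nonempty →
      (∀ x ∈ paths T, ¬ Computable x) →
      ∃ T' : Set (List ℕ), IsTree T' ∧ Sigma11List T' ∧ (paths T').Nonempty ∧
        (∀ x ∈ paths T ∪ paths T', ¬ Computable x) ∧
        ¬ MedvedevLE (paths T) (paths T ∪ paths T') ∧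
        MedvedevLT Set.univ (paths T ∪ paths T') ∧
        MedvedevLT (paths T ∪ paths T') (paths T) := by
  intro T hT hS _ hcomp
  obtain ⟨u, hu, hgraph⟩ := (sigma11Pred_extendsOutput hS).exists_uniformization
    (exists_not_extendsOutput hT hcomp)
  have hAB : ∀ x ∈ paths T ∪ paths (diagTree u), ¬ Computable x := by
    rintro x (hx | hx)
    · exact hcomp x hx
    · exact not_computable_of_mem_paths_diagTree hx
  have hnot : ¬ MedvedevLE (paths T) (paths T ∪ paths (diagTree u)) := by
    rintro ⟨Φ, hΦ⟩
    exact not_medvedevLE_diagTree hu ⟨Φ, fun x hx => hΦ x (Or.inr hx)⟩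
  obtain ⟨x, hx, -⟩ := exists_mem_paths_diagTree u 0
  exact ⟨diagTree u, isTree_diagTree u, sigma11List_diagTree hgraph, ⟨x, hx⟩, hAB, hnot,
    ⟨medvedevLE_of_superset (subset_univ _), not_medvedevLE_univ hAB⟩,
    ⟨medvedevLE_of_superset subset_union_left, hnot⟩⟩
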